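/- The harmonic decomposition of a homogeneous polynomial is unique: if h_0, h_1, …, h_{⌊d/2⌋} are polynomials in n real variables such that each h_j is homogeneous of degree d − 2j, Δh_j = 0 for all j, and Σ_{j=0}^{⌊d/2⌋} q^j · h_j = 0, where q = Σ_{i=1}^{n} x_i², then h_j = 0 for every j. -/

import Mathlib

open MvPolynomial Finset

/-- The polynomial Laplacian `Δp = ∑ i, ∂²p/∂xᵢ²`. -/
noncomputable def polyLaplacian {n : ℕ} (p : MvPolynomial (Fin n) ℝ) :
    MvPolynomial (Fin n) ℝ :=
  ∑ i : Fin n, pderiv i (pderiv i p)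

theorem polyLaplacian_add {n : ℕ} (p r : MvPolynomial (Fin n) ℝ) :
    polyLaplacian (p + r) = polyLaplacian p + polyLaplacian r := by
  simp [polyLaplacian, Finset.sum_add_distrib]

theorem polyLaplacian_zero {n : ℕ} : polyLaplacian (0 : MvPolynomial (Fin n) ℝ) = 0 := by
  simp [polyLaplacian]

theorem polyLaplacian_C_mul {n : ℕ} (c : ℝ) (p : MvPolynomial (Fin n) ℝ) :
    polyLaplacian (C c * p) = C c * polyLaplacian p := by
  simp [polyLaplacian, Finset.mul_sum]

theorem polyLaplacian_sum {n : ℕ} {ι : Type*} (s : Finset ι)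
    (f : ι → MvPolynomial (Fin n) ℝ) :
    polyLaplacian (∑ j ∈ s, f j) = ∑ j ∈ s, polyLaplacian (f j) := by
  simp only [polyLaplacian, map_sum]
  exact Finset.sum_comm

theorem pderiv_sum_X_sq {n : ℕ} (i : Fin n) :
    pderiv i (∑ j : Fin n, (X j : MvPolynomial (Fin n) ℝ) ^ 2) = 2 * X i := by
  rw [map_sum, Finset.sum_eq_single i]
  · simp
  · intro j _ hj
    simp [pderiv_X_of_ne hj]
  · simp

/-- `Δ(q p) = (2n + 4m) p + q Δp` for `p` homogeneous of degree `m`. -/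
theorem polyLaplacian_sum_X_sq_mul {n m : ℕ} {p : MvPolynomial (Fin n) ℝ}
    (hp : p.IsHomogeneous m) :
    polyLaplacian ((∑ i : Fin n, X i ^ 2) * p) =
      C (2 * n + 4 * m : ℝ) * p + (∑ i : Fin n, X i ^ 2) * polyLaplacian p := by
  have hE := hp.sum_X_mul_pderiv
  have hterm (i : Fin n) :
      pderiv i (pderiv i ((∑ j : Fin n, X j ^ 2) * p)) =
        2 * p + 4 * (X i * pderiv i p) + (∑ j : Fin n, X j ^ 2) * pderiv i (pderiv i p) := by
    have h2 : pderiv i (2 : MvPolynomial (Fin n) ℝ) = 0 := (pderiv i).map_natCast 2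
    simp only [pderiv_mul, map_add, pderiv_sum_X_sq, pderiv_X_self, h2]
    ring
  simp only [polyLaplacian, hterm, Finset.sum_add_distrib, ← Finset.mul_sum, hE]
  simp only [Finset.sum_const, Finset.card_univ, Fintype.card_fin, nsmul_eq_mul, map_add, map_mul,
    map_natCast, map_ofNat]
  ring

theorem isHomogeneous_sum_X_sq (n : ℕ) :
    (∑ i : Fin n, (X i : MvPolynomial (Fin n) ℝ) ^ 2).IsHomogeneous 2 :=
  IsHomogeneous.sum _ _ _ fun i _ => isHomogeneous_X_pow i 2

/-- For `p` harmonic and homogeneous, `Δ(qᵏ⁺¹ p)` is a positive multiple of `qᵏ p`. -/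
theorem exists_polyLaplacian_sum_X_sq_pow_mul {n m : ℕ} (hn : 1 ≤ n)
    {p : MvPolynomial (Fin n) ℝ} (hp : p.IsHomogeneous m) (hharm : polyLaplacian p = 0) (k : ℕ) :
    ∃ c : ℝ, 0 < c ∧ polyLaplacian ((∑ i : Fin n, X i ^ 2) ^ (k + 1) * p) =
      C c * ((∑ i : Fin n, X i ^ 2) ^ k * p) := by
  have hn' : (0 : ℝ) < n := by exact_mod_cast hn
  induction k with
  | zero =>
    refine ⟨2 * n + 4 * m, by positivity, ?_⟩
    rw [zero_add, pow_one, polyLaplacian_sum_X_sq_mul hp, hharm, mul_zero, add_zero, pow_zero,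
      one_mul]
  | succ k ih =>
    obtain ⟨c, hc, h⟩ := ih
    refine ⟨2 * n + 4 * (2 * (k + 1) + m : ℕ) + c, by positivity, ?_⟩
    rw [pow_succ', mul_assoc,
      polyLaplacian_sum_X_sq_mul (((isHomogeneous_sum_X_sq n).pow (k + 1)).mul hp), h]
    simp only [C_add]
    ring

/-- If `∑_{j < N} qʲ hⱼ = 0` with every `hⱼ` harmonic and homogeneous, then every `hⱼ` vanishes. -/
theorem eq_zero_of_sum_sum_X_sq_pow_mul_eq_zero {n : ℕ} (hn : 1 ≤ n) (N : ℕ) (m : ℕ → ℕ)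
    (h : ℕ → MvPolynomial (Fin n) ℝ)
    (hhom : ∀ j < N, (h j).IsHomogeneous (m j))
    (hharm : ∀ j < N, polyLaplacian (h j) = 0)
    (hsum : ∑ j ∈ Finset.range N, (∑ i : Fin n, X i ^ 2) ^ j * h j = 0) :
    ∀ j < N, h j = 0 := by
  induction N generalizing m h with
  | zero => simp
  | succ N ih =>
    have hex (j : ℕ) : ∃ c : ℝ, 0 < c ∧ (j < N →
        polyLaplacian ((∑ i : Fin n, X i ^ 2) ^ (j + 1) * h (j + 1)) =
          C c * ((∑ i : Fin n, X i ^ 2) ^ j * h (j + 1))) := by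
      by_cases hj : j < N
      · obtain ⟨c, hc, he⟩ := exists_polyLaplacian_sum_X_sq_pow_mul hn
          (hhom (j + 1) (by omega)) (hharm (j + 1) (by omega)) j
        exact ⟨c, hc, fun _ => he⟩
      · exact ⟨1, one_pos, fun hj' => absurd hj' hj⟩
    choose c hc hΔ using hex
    have htail : ∀ j < N, h (j + 1) = 0 := by
      have hzero := ih (fun j => m (j + 1)) (fun j => C (c j) * h (j + 1))
        (fun j hj => (hhom (j + 1) (by omega)).C_mul _)
        (fun j hj => by rw [polyLaplacian_C_mul, hharm (j + 1) (by omega), mul_zero]) (by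
          have := congrArg polyLaplacian hsum
          rw [Finset.sum_range_succ', polyLaplacian_add, pow_zero, one_mul,
            hharm 0 (by omega), add_zero, polyLaplacian_sum, polyLaplacian_zero] at this
          rw [← this]
          refine Finset.sum_congr rfl fun j hj => ?_
          rw [hΔ j (Finset.mem_range.mp hj)]
          ring)
      intro j hj
      exact (mul_eq_zero.mp (hzero j hj)).resolve_left (C_ne_zero.mpr (hc j).ne')
    rw [Finset.sum_range_succ', Finset.sum_eq_zero, zero_add, pow_zero, one_mul] at hsum
    · rintro (_ | j) hj
      · exact hsum
      · exact htail j (by omega)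
    · intro j hj
      rw [htail j (Finset.mem_range.mp hj), mul_zero]

/-- Uniqueness of the harmonic decomposition: if each `hⱼ` (for `0 ≤ j ≤ ⌊d/2⌋`) is
harmonic and homogeneous of degree `d - 2j`, and `∑_{j=0}^{⌊d/2⌋} qʲ · hⱼ = 0` with
`q = ∑ xᵢ²`, then every `hⱼ` vanishes. -/
theorem harmonic_decomposition_unique (n d : ℕ) (hn : 1 ≤ n)
    (h : ℕ → MvPolynomial (Fin n) ℝ)
    (hhom : ∀ j ≤ d / 2, (h j).IsHomogeneous (d - 2 * j))
    (hharm : ∀ j ≤ d / 2, polyLaplacian (h j) = 0)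
    (hsum : ∑ j ∈ Finset.range (d / 2 + 1), (∑ i : Fin n, X i ^ 2) ^ j * h j = 0) :
    ∀ j ≤ d / 2, h j = 0 := by
  intro j hj
  exact eq_zero_of_sum_sum_X_sq_pow_mul_eq_zero hn (d / 2 + 1) (fun j => d - 2 * j) h
    (fun j hj => hhom j (by omega)) (fun j hj => hharm j (by omega)) hsum j (by omega)
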